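/- arXiv:2506.05544 — 6 statements merged into one kernel-verified Lean document; each statement's English description precedes it below -/
import Mathlib

section
/- Let ᾱ ∈ (0,1), λ_max > 0, c ∈ (0,1) and γ = c·λ_max. Let (α_t)_{t∈ℕ} and (β_t)_{t∈ℕ} be real sequences with α_t ∈ [0,1] and β_t ∈ [0,1] for all t, let e_t := 1{α_t > β_t}, and let (λ_t)_{t∈ℕ} satisfy λ_{t+1} = λ_t + γ·(e_t − ᾱ) with λ_0 ∈ [0, λ_max]. Assume the saturation rule (α_t = 0 whenever λ_t ≥ λ_max) and the floor rule (α_t > β_t whenever λ_t ≤ 0). Then for every nonnegative integer n and every positive integer T, | (1/T)·Σ_{t=n}^{n+T−1} e_t − ᾱ | ≤ (c+1)/(c·T). -/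
/-- A sequence with increments `γ * (e t - a)`, `e t ∈ [0, 1]`, that is forced down above `M` and
up below `0` leaves `[0, M]` by at most one step. -/
theorem mem_Icc_of_feedback {a M γ : ℝ} (ha : a ∈ Set.Icc (0:ℝ) 1) (hγ : 0 ≤ γ)
    {lam e : ℕ → ℝ} (he : ∀ t, e t ∈ Set.Icc (0:ℝ) 1)
    (hlam : ∀ t, lam (t + 1) = lam t + γ * (e t - a)) (h0 : lam 0 ∈ Set.Icc 0 M)
    (hsat : ∀ t, M ≤ lam t → e t = 0) (hfloor : ∀ t, lam t ≤ 0 → e t = 1) (t : ℕ) :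
    lam t ∈ Set.Icc (-(γ * a)) (M + γ * (1 - a)) := by
  have h1 : 0 ≤ γ * a := mul_nonneg hγ ha.1
  have h2 : 0 ≤ γ * (1 - a) := mul_nonneg hγ (sub_nonneg.2 ha.2)
  induction t with
  | zero => exact ⟨by linarith [h0.1], by linarith [h0.2]⟩
  | succ t ih =>
    rw [hlam t]
    have h3 : 0 ≤ γ * e t := mul_nonneg hγ (he t).1
    have h4 : 0 ≤ γ * (1 - e t) := mul_nonneg hγ (sub_nonneg.2 (he t).2)
    constructor
    · rcases le_or_gt (lam t) 0 with h | h
      · rw [hfloor t h]; linarith [ih.1]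
      · linarith
    · rcases le_or_gt M (lam t) with h | h
      · rw [hsat t h]; linarith [ih.2]
      · linarith

/-- Telescoping of the recursion `lam (t + 1) = lam t + γ * (e t - a)`. -/
theorem sub_eq_mul_sum_Ico {a γ : ℝ} {lam e : ℕ → ℝ}
    (hlam : ∀ t, lam (t + 1) = lam t + γ * (e t - a)) (n T : ℕ) :
    lam (n + T) - lam n = γ * (∑ t ∈ Finset.Ico n (n + T), e t - T * a) := by
  induction T with
  | zero => simp
  | succ T ih =>
    rw [← add_assoc, hlam, Finset.sum_Ico_succ_top (by omega)]
    push_cast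
    linarith

/-- Theorem 1 of the paper (deterministic form): the long-run coverage-control
guarantee of the MPS/BCI calibration. -/
theorem mps_theorem1
    (abar lmax c γ : ℝ)
    (habar : abar ∈ Set.Ioo (0:ℝ) 1) (hlmax : 0 < lmax)
    (hc : c ∈ Set.Ioo (0:ℝ) 1) (hγ : γ = c * lmax)
    (α β lam e : ℕ → ℝ)
    (hα : ∀ t, α t ∈ Set.Icc (0:ℝ) 1)
    (hβ : ∀ t, β t ∈ Set.Icc (0:ℝ) 1)
    (he : ∀ t, e t = if β t < α t then 1 else 0)
    (hlam : ∀ t, lam (t + 1) = lam t + γ * (e t - abar))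
    (hlam0 : lam 0 ∈ Set.Icc (0:ℝ) lmax)
    (hsat : ∀ t, lmax ≤ lam t → α t = 0)
    (hfloor : ∀ t, lam t ≤ 0 → β t < α t)
    (n T : ℕ) (hT : 0 < T) :
    |(1 / (T:ℝ)) * (∑ t ∈ Finset.Ico n (n + T), e t) - abar| ≤ (c + 1) / (c * T) := by
  subst hγ
  have hγ : 0 < c * lmax := mul_pos hc.1 hlmax
  have hT' : (0:ℝ) < T := Nat.cast_pos.2 hT
  have hmem : ∀ t, lam t ∈ Set.Icc (-(c * lmax * abar)) (lmax + c * lmax * (1 - abar)) := by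
    refine mem_Icc_of_feedback (Set.Ioo_subset_Icc_self habar) hγ.le (fun t => ?_)
      hlam hlam0 (fun t h => ?_) (fun t h => ?_)
    · rw [he t]
      split_ifs <;> simp
    · rw [he t, hsat t h, if_neg (hβ t).1.not_gt]
    · rw [he t, if_pos (hfloor t h)]
  have htel := sub_eq_mul_sum_Ico hlam n T
  set S := ∑ t ∈ Finset.Ico n (n + T), e t
  have habs : |lam (n + T) - lam n| ≤ lmax * (c + 1) := by
    have h1 := hmem n
    have h2 := hmem (n + T)
    rw [abs_le]
    constructor <;> linarith [h1.1, h1.2, h2.1, h2.2]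
  rw [htel, abs_mul, abs_of_pos hγ] at habs
  have hkey : c * |S - T * abar| ≤ c + 1 :=
    le_of_mul_le_mul_left (by linarith) hlmax
  have hrw : 1 / (T:ℝ) * S - abar = (S - T * abar) / T := by
    field_simp
  rw [hrw, abs_div, abs_of_pos hT', ← div_div]
  gcongr
  rw [le_div_iff₀ hc.1]
  linarith
end

section
/- Let ᾱ ∈ (0,1), λ_max > 0, γ > 0. Let (α_t)_{t∈ℕ} and (β_t)_{t∈ℕ} be real sequences with α_t ∈ [0,1] and β_t ∈ [0,1] for all t, let e_t := 1{α_t > β_t}, and let (λ_t)_{t∈ℕ} satisfy λ_{t+1} = λ_t + γ·(e_t − ᾱ) with λ_0 ∈ [0, λ_max]. Assume the saturation rule (α_t = 0 whenever λ_t ≥ λ_max) and the floor rule (α_t > β_t whenever λ_t ≤ 0). Then for all t ∈ ℕ, −γ·ᾱ ≤ λ_t ≤ λ_max + γ·(1 − ᾱ); in particular sup_t λ_t − inf_t λ_t ≤ λ_max + γ. -/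
/-- The boundedness lemma underlying Theorem 1 of the paper: the adaptive
penalty weight stays in a bounded interval, whose length is at most lmax + γ. -/
theorem mps_lambda_bounded
    (abar lmax γ : ℝ)
    (habar : abar ∈ Set.Ioo (0:ℝ) 1) (hlmax : 0 < lmax) (hγ : 0 < γ)
    (α β lam e : ℕ → ℝ)
    (hα : ∀ t, α t ∈ Set.Icc (0:ℝ) 1)
    (hβ : ∀ t, β t ∈ Set.Icc (0:ℝ) 1)
    (he : ∀ t, e t = if β t < α t then 1 else 0)
    (hlam : ∀ t, lam (t + 1) = lam t + γ * (e t - abar))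
    (hlam0 : lam 0 ∈ Set.Icc (0:ℝ) lmax)
    (hsat : ∀ t, lmax ≤ lam t → α t = 0)
    (hfloor : ∀ t, lam t ≤ 0 → β t < α t) :
    (∀ t, -(γ * abar) ≤ lam t ∧ lam t ≤ lmax + γ * (1 - abar)) ∧
      (⨆ t, lam t) - (⨅ t, lam t) ≤ lmax + γ := by
  have hγa : 0 < γ * abar := mul_pos hγ habar.1
  have hγb : 0 < γ * (1 - abar) := mul_pos hγ (sub_pos.2 habar.2)
  have hbound : ∀ t, -(γ * abar) ≤ lam t ∧ lam t ≤ lmax + γ * (1 - abar) := by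
    intro t
    induction t with
    | zero => exact ⟨by linarith [hlam0.1], by linarith [hlam0.2]⟩
    | succ t ih =>
      rw [hlam, he]
      split_ifs with h
      · have hlt : lam t < lmax := by
          by_contra! hge
          linarith [hsat t hge, (hβ t).1]
        exact ⟨by linarith [ih.1], by linarith⟩
      · have hpos : 0 < lam t := by
          by_contra! hle
          exact h (hfloor t hle)
        exact ⟨by linarith, by linarith [ih.2]⟩
  refine ⟨hbound, ?_⟩
  have hsup : (⨆ t, lam t) ≤ lmax + γ * (1 - abar) := ciSup_le fun t => (hbound t).2
  have hinf : -(γ * abar) ≤ ⨅ t, lam t := le_ciInf fun t => (hbound t).1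
  linarith
end

section
/- Let ᾱ ∈ (0,1), λ_max > 0, c ∈ (0,1) and γ = c·λ_max. Let (α_t)_{t∈ℕ} and (β_t)_{t∈ℕ} be real sequences with α_t ∈ [0,1] and β_t ∈ [0,1] for all t, let e_t := 1{α_t > β_t}, and let (λ_t)_{t∈ℕ} satisfy λ_{t+1} = λ_t + γ·(e_t − ᾱ) with λ_0 ∈ [0, λ_max]. Assume the saturation rule (α_t = 0 whenever λ_t ≥ λ_max) and the floor rule (α_t > β_t whenever λ_t ≤ 0). Then the long-run empirical miscoverage rate converges to the target: lim_{T→∞} (1/T)·Σ_{t=0}^{T−1} e_t = ᾱ. -/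
/-- If an additive integrator `x (t + 1) = x t + γ * (e t - a)` with nonzero gain stays bounded,
then the Cesàro averages of its input `e` converge to `a`. -/
theorem tendsto_average_of_bounded_integrator {a γ B : ℝ} (hγ : γ ≠ 0) {x e : ℕ → ℝ}
    (hx : ∀ t, x (t + 1) = x t + γ * (e t - a)) (hB : ∀ t, |x t - x 0| ≤ B) :
    Filter.Tendsto (fun T : ℕ => (1 / (T : ℝ)) * ∑ t ∈ Finset.range T, e t)
      Filter.atTop (nhds a) := by
  have hsum (T : ℕ) : γ * (∑ t ∈ Finset.range T, e t - T * a) = x T - x 0 := by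
    induction T with
    | zero => simp
    | succ n ih =>
      rw [Finset.sum_range_succ, hx]
      push_cast
      linear_combination ih
  rw [tendsto_iff_norm_sub_tendsto_zero]
  refine squeeze_zero' (Filter.Eventually.of_forall fun _ => norm_nonneg _) ?_
    (tendsto_const_div_atTop_nhds_zero_nat (B / |γ|))
  filter_upwards [Filter.eventually_gt_atTop 0] with T hT
  have hT' : (0 : ℝ) < T := by exact_mod_cast hT
  have heq : (1 / (T : ℝ)) * ∑ t ∈ Finset.range T, e t - a = (x T - x 0) / γ / T := by
    rw [← hsum T]
    field_simp
  rw [heq, Real.norm_eq_abs, abs_div, abs_div, abs_of_pos hT']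
  gcongr
  exact hB T

/-- An integrator driven by a `{0, 1}`-valued input that is `1` below `0` and `0` above `M`
overshoots the interval `[0, M]` by at most its gain. -/
theorem integrator_mem_Icc {a γ M : ℝ} (ha : a ∈ Set.Icc (0 : ℝ) 1) (hγ : 0 ≤ γ)
    {x e : ℕ → ℝ} (he : ∀ t, e t ∈ Set.Icc (0 : ℝ) 1)
    (hx : ∀ t, x (t + 1) = x t + γ * (e t - a)) (hx0 : x 0 ∈ Set.Icc 0 M)
    (hlow : ∀ t, x t ≤ 0 → e t = 1) (hhigh : ∀ t, M ≤ x t → e t = 0) (t : ℕ) :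
    x t ∈ Set.Icc (-γ) (M + γ) := by
  induction t with
  | zero => exact ⟨by linarith [hx0.1], by linarith [hx0.2]⟩
  | succ n ih =>
    obtain ⟨ha0, ha1⟩ := ha
    obtain ⟨he0, he1⟩ := he n
    obtain ⟨hn0, hn1⟩ := ih
    have hup : γ * (e n - a) ≤ γ := by nlinarith
    have hdown : -γ ≤ γ * (e n - a) := by nlinarith
    rw [hx, Set.mem_Icc]
    constructor
    · rcases le_total (x n) 0 with h | h
      · rw [hlow n h]
        nlinarith
      · linarith
    · rcases le_total M (x n) with h | h
      · rw [hhigh n h]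
        nlinarith
      · linarith

/-- Long-run coverage consequence of Theorem 1 of the paper: the empirical
miscoverage rate converges to the target rate. -/
theorem mps_long_run_coverage
    (abar lmax c γ : ℝ)
    (habar : abar ∈ Set.Ioo (0:ℝ) 1) (hlmax : 0 < lmax)
    (hc : c ∈ Set.Ioo (0:ℝ) 1) (hγ : γ = c * lmax)
    (α β lam e : ℕ → ℝ)
    (hα : ∀ t, α t ∈ Set.Icc (0:ℝ) 1)
    (hβ : ∀ t, β t ∈ Set.Icc (0:ℝ) 1)
    (he : ∀ t, e t = if β t < α t then 1 else 0)
    (hlam : ∀ t, lam (t + 1) = lam t + γ * (e t - abar))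
    (hlam0 : lam 0 ∈ Set.Icc (0:ℝ) lmax)
    (hsat : ∀ t, lmax ≤ lam t → α t = 0)
    (hfloor : ∀ t, lam t ≤ 0 → β t < α t) :
    Filter.Tendsto (fun T : ℕ => (1 / (T:ℝ)) * ∑ t ∈ Finset.range T, e t)
      Filter.atTop (nhds abar) := by
  have hγ0 : 0 < γ := hγ ▸ mul_pos hc.1 hlmax
  have hmem : ∀ t, lam t ∈ Set.Icc (-γ) (lmax + γ) := by
    refine integrator_mem_Icc ⟨habar.1.le, habar.2.le⟩ hγ0.le ?_ hlam hlam0 ?_ ?_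
    · intro t
      rw [he]
      split_ifs <;> norm_num
    · intro t ht
      rw [he, if_pos (hfloor t ht)]
    · intro t ht
      rw [he, hsat t ht, if_neg (hβ t).1.not_gt]
  refine tendsto_average_of_bounded_integrator (B := lmax + γ) hγ0.ne' hlam fun t => ?_
  obtain ⟨h1, h2⟩ := hmem t
  obtain ⟨h3, h4⟩ := hlam0
  exact abs_le.2 ⟨by linarith, by linarith⟩
end

section
/- Let ᾱ ∈ (0,1), λ_max > 0, c ∈ (0,1) and γ = c·λ_max. Let (α_t)_{t∈ℕ} and (β_t)_{t∈ℕ} be real sequences with α_t ∈ [0,1] and β_t ∈ [0,1] for all t, let e_t := 1{α_t > β_t}, and let (λ_t)_{t∈ℕ} satisfy λ_{t+1} = λ_t + γ·(e_t − ᾱ) with λ_0 ∈ [0, λ_max]. Assume only the saturation rule: α_t = 0 whenever λ_t ≥ λ_max. Then for every positive integer T, (1/T)·Σ_{t=0}^{T−1} e_t ≤ ᾱ + (c+1)/(c·T); in particular, limsup_{T→∞} (1/T)·Σ_{t=0}^{T−1} e_t ≤ ᾱ. -/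
/-- If a sequence increases by at most `δ` per step, and does not increase while it is at or above
`M`, then it stays below `M + δ`. -/
theorem le_add_of_step_le_of_saturated {x : ℕ → ℝ} {M δ : ℝ} (hδ : 0 ≤ δ) (h0 : x 0 ≤ M)
    (hstep : ∀ t, x (t + 1) ≤ x t + δ) (hsat : ∀ t, M ≤ x t → x (t + 1) ≤ x t) (t : ℕ) :
    x t ≤ M + δ := by
  induction t with
  | zero => linarith
  | succ t ih =>
    rcases le_total M (x t) with h | h
    · exact (hsat t h).trans ih
    · linarith [hstep t]

/-- Upper miscoverage bound underlying Theorem 1 of the paper: the saturation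
mechanism alone guarantees that the long-run empirical miscoverage rate does
not exceed the target. -/
theorem mps_upper_bound
    (abar lmax c γ : ℝ)
    (habar : abar ∈ Set.Ioo (0:ℝ) 1) (hlmax : 0 < lmax)
    (hc : c ∈ Set.Ioo (0:ℝ) 1) (hγ : γ = c * lmax)
    (α β lam e : ℕ → ℝ)
    (hα : ∀ t, α t ∈ Set.Icc (0:ℝ) 1)
    (hβ : ∀ t, β t ∈ Set.Icc (0:ℝ) 1)
    (he : ∀ t, e t = if β t < α t then 1 else 0)
    (hlam : ∀ t, lam (t + 1) = lam t + γ * (e t - abar))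
    (hlam0 : lam 0 ∈ Set.Icc (0:ℝ) lmax)
    (hsat : ∀ t, lmax ≤ lam t → α t = 0) :
    (∀ T : ℕ, 0 < T →
      (1 / (T:ℝ)) * (∑ t ∈ Finset.range T, e t) ≤ abar + (c + 1) / (c * T)) ∧
      Filter.limsup (fun T : ℕ => (1 / (T:ℝ)) * ∑ t ∈ Finset.range T, e t)
        Filter.atTop ≤ abar := by
  have hc0 := hc.1
  have hγ0 : 0 < γ := hγ ▸ mul_pos hc0 hlmax
  have he0 : ∀ t, 0 ≤ e t := fun t ↦ by rw [he]; split_ifs <;> norm_num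
  have he1 : ∀ t, e t ≤ 1 := fun t ↦ by rw [he]; split_ifs <;> norm_num
  have hlam_le : ∀ t, lam t ≤ lmax + γ := by
    refine le_add_of_step_le_of_saturated hγ0.le hlam0.2 (fun t ↦ ?_) fun t ht ↦ ?_
    · nlinarith [hlam t, he1 t, habar.1]
    · have het : e t = 0 := by rw [he, hsat t ht, if_neg (hβ t).1.not_gt]
      rw [hlam, het]
      nlinarith [habar.1]
  have hlam_eq : ∀ T : ℕ, lam T = lam 0 + γ * (∑ t ∈ Finset.range T, e t - T * abar) := by
    intro T
    induction T with
    | zero => simp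
    | succ T ih =>
      rw [hlam, ih, Finset.sum_range_succ]
      push_cast
      ring
  have hbound : ∀ T : ℕ, 0 < T →
      (1 / (T:ℝ)) * (∑ t ∈ Finset.range T, e t) ≤ abar + (c + 1) / (c * T) := by
    intro T hT
    have hT' : (0:ℝ) < T := Nat.cast_pos.2 hT
    have hsum : c * (∑ t ∈ Finset.range T, e t - T * abar) ≤ c + 1 := by
      refine le_of_mul_le_mul_left ?_ hlmax
      have h := hlam_le T
      rw [hlam_eq, hγ] at h
      linarith [hlam0.1]
    calc (1 / (T:ℝ)) * ∑ t ∈ Finset.range T, e t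
        = abar + c * (∑ t ∈ Finset.range T, e t - T * abar) / (c * T) := by
          field_simp
          ring
      _ ≤ abar + (c + 1) / (c * T) := by gcongr
  refine ⟨hbound, ?_⟩
  have hlim : Filter.Tendsto (fun T : ℕ ↦ abar + (c + 1) / (c * T)) Filter.atTop (nhds abar) := by
    have h := (tendsto_const_nhds (x := c + 1)).div_atTop
      (tendsto_natCast_atTop_atTop.const_mul_atTop hc0 : Filter.Tendsto (fun T : ℕ ↦ c * (T:ℝ)) _ _)
    simpa using h.const_add abar
  rw [← hlim.limsup_eq]
  refine Filter.limsup_le_limsup ?_ ?_ hlim.isBoundedUnder_le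
  · filter_upwards [Filter.eventually_gt_atTop 0] with T hT using hbound T hT
  · refine Filter.IsBoundedUnder.isCoboundedUnder_le (Filter.isBoundedUnder_of ⟨0, fun T ↦ ?_⟩)
    exact mul_nonneg (by positivity) (Finset.sum_nonneg fun t _ ↦ he0 t)
end

section
/- Let ᾱ ∈ (0,1), λ_max > 0, c ∈ (0,1) and γ = c·λ_max. Let (α_t)_{t∈ℕ} and (β_t)_{t∈ℕ} be real sequences with α_t ∈ [0,1] and β_t ∈ [0,1] for all t, let e_t := 1{α_t > β_t}, and let (λ_t)_{t∈ℕ} satisfy λ_{t+1} = λ_t + γ·(e_t − ᾱ) with λ_0 ∈ [0, λ_max]. Assume only the floor rule: α_t > β_t whenever λ_t ≤ 0. Then for every positive integer T, (1/T)·Σ_{t=0}^{T−1} e_t ≥ ᾱ − (c+1)/(c·T); in particular, liminf_{T→∞} (1/T)·Σ_{t=0}^{T−1} e_t ≥ ᾱ. -/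
/-- A weight that is incremented by `γ * (e t - a)`, with increments that are nonnegative whenever
the weight is nonpositive, never falls below `-γ`. -/
theorem neg_le_weight {a γ : ℝ} {lam e : ℕ → ℝ} (ha1 : a ≤ 1) (hγ : 0 ≤ γ)
    (he0 : ∀ t, 0 ≤ e t) (hlam : ∀ t, lam (t + 1) = lam t + γ * (e t - a))
    (hlam0 : -γ ≤ lam 0) (hfloor : ∀ t, lam t ≤ 0 → e t = 1) (t : ℕ) : -γ ≤ lam t := by
  induction t with
  | zero => exact hlam0
  | succ t ih =>
    rw [hlam]
    rcases le_or_gt (lam t) 0 with h | h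
    · rw [hfloor t h]
      nlinarith
    · nlinarith [mul_nonneg hγ (he0 t), mul_le_of_le_one_right hγ ha1]

/-- The weight recursion telescopes. -/
theorem weight_eq_add_sum {a γ : ℝ} {lam e : ℕ → ℝ}
    (hlam : ∀ t, lam (t + 1) = lam t + γ * (e t - a)) (T : ℕ) :
    lam T = lam 0 + γ * (∑ t ∈ Finset.range T, e t - T * a) := by
  induction T with
  | zero => simp
  | succ T ih =>
    rw [hlam, ih, Finset.sum_range_succ]
    push_cast
    ring

/-- A sequence bounded above, and bounded below by `a - K / (c * T)` for positive `T`, has lower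
limit at least `a`. -/
theorem le_liminf_of_sub_div_le {a K c M : ℝ} {u : ℕ → ℝ} (hu : ∀ T, u T ≤ M) (hc : 0 < c)
    (h : ∀ T : ℕ, 0 < T → a - K / (c * T) ≤ u T) : a ≤ Filter.liminf u Filter.atTop := by
  have hlim : Filter.Tendsto (fun T : ℕ => a - K / (c * T)) Filter.atTop (nhds a) := by
    have h0 : Filter.Tendsto (fun T : ℕ => K / (c * T)) Filter.atTop (nhds 0) :=
      Filter.Tendsto.const_div_atTop (tendsto_natCast_atTop_atTop.const_mul_atTop hc) K
    simpa using h0.const_sub a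
  rw [← hlim.liminf_eq]
  refine Filter.liminf_le_liminf ?_ hlim.isBoundedUnder_ge ?_
  · filter_upwards [Filter.eventually_gt_atTop 0] with T hT using h T hT
  · exact (Filter.isBoundedUnder_of ⟨M, hu⟩).isCoboundedUnder_ge

/-- Lower miscoverage bound underlying Theorem 1 of the paper: the floor
mechanism alone guarantees that the long-run empirical miscoverage rate is not
smaller than the target. -/
theorem mps_lower_bound
    (abar lmax c γ : ℝ)
    (habar : abar ∈ Set.Ioo (0:ℝ) 1) (hlmax : 0 < lmax)
    (hc : c ∈ Set.Ioo (0:ℝ) 1) (hγ : γ = c * lmax)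
    (α β lam e : ℕ → ℝ)
    (hα : ∀ t, α t ∈ Set.Icc (0:ℝ) 1)
    (hβ : ∀ t, β t ∈ Set.Icc (0:ℝ) 1)
    (he : ∀ t, e t = if β t < α t then 1 else 0)
    (hlam : ∀ t, lam (t + 1) = lam t + γ * (e t - abar))
    (hlam0 : lam 0 ∈ Set.Icc (0:ℝ) lmax)
    (hfloor : ∀ t, lam t ≤ 0 → β t < α t) :
    (∀ T : ℕ, 0 < T →
      abar - (c + 1) / (c * T) ≤ (1 / (T:ℝ)) * (∑ t ∈ Finset.range T, e t)) ∧
      abar ≤ Filter.liminf (fun T : ℕ => (1 / (T:ℝ)) * ∑ t ∈ Finset.range T, e t)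
        Filter.atTop := by
  have he0 : ∀ t, 0 ≤ e t := fun t => by rw [he]; split_ifs <;> norm_num
  have he1 : ∀ t, e t ≤ 1 := fun t => by rw [he]; split_ifs <;> norm_num
  have hγ0 : 0 < γ := hγ ▸ mul_pos hc.1 hlmax
  have hbound : ∀ T : ℕ, 0 < T →
      abar - (c + 1) / (c * T) ≤ (1 / (T : ℝ)) * ∑ t ∈ Finset.range T, e t := by
    intro T hT
    have hT' : (0 : ℝ) < T := Nat.cast_pos.mpr hT
    have hlow := neg_le_weight habar.2.le hγ0.le he0 hlam
      (by linarith [hlam0.1]) (fun t ht => by rw [he, if_pos (hfloor t ht)]) T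
    rw [weight_eq_add_sum hlam T] at hlow
    have hsum : 0 ≤ c * (∑ t ∈ Finset.range T, e t - T * abar) + (c + 1) := by
      refine nonneg_of_mul_nonneg_right (a := lmax) ?_ hlmax
      rw [hγ] at hlow
      linarith [hlam0.2]
    have hkey : (1 / (T : ℝ)) * ∑ t ∈ Finset.range T, e t - (abar - (c + 1) / (c * T)) =
        (c * (∑ t ∈ Finset.range T, e t - T * abar) + (c + 1)) / (c * T) := by
      have := hc.1.ne'
      field_simp
      ring
    exact sub_nonneg.mp (hkey ▸ div_nonneg hsum (mul_pos hc.1 hT').le)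
  refine ⟨hbound, le_liminf_of_sub_div_le (M := 1) (fun T => ?_) hc.1 hbound⟩
  rw [one_div_mul_eq_div]
  refine div_le_one_of_le₀ ?_ T.cast_nonneg
  simpa using Finset.sum_le_sum fun t (_ : t ∈ Finset.range T) => he1 t
end

section
/- Let 𝓜 be a nonempty set. For each t ∈ ℕ let C_t : [0,1] → Set 𝓜, written C_t(1−β) for β ∈ [0,1], satisfy monotonicity (β₁ > β₂ implies C_t(1−β₁) ⊆ C_t(1−β₂)) and the safeguard C_t(1) = 𝓜, and let M_{t+1} ∈ 𝓜. Define β_t := sup{β ∈ [0,1] : M_{t+1} ∈ C_t(1−β)} and assume each supremum is attained, i.e., M_{t+1} ∈ C_t(1−β_t). Let ᾱ ∈ (0,1), λ_max > 0, c ∈ (0,1), γ = c·λ_max, let (α_t)_{t∈ℕ} be a sequence in [0,1], and let (λ_t)_{t∈ℕ} satisfy λ_{t+1} = λ_t + γ·(1{α_t > β_t} − ᾱ) with λ_0 ∈ [0, λ_max]. Assume α_t = 0 whenever λ_t ≥ λ_max. Then lim_{T→∞} (1/T)·Σ_{t=0}^{T−1} 1{M_{t+1} ∉ C_t(1−α_t)}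 ≤ ᾱ, and moreover (1/T)·Σ_{t=0}^{T−1} 1{M_{t+1} ∉ C_t(1−α_t)} ≤ ᾱ + (c+1)/(c·T) for every positive integer T. -/
open Classical

/-- If `α t` vanishes whenever the dual variable reaches `lmax`, the dual variable
overshoots `lmax` by at most one step. -/
theorem dual_variable_le {abar lmax γ : ℝ} {β α lam : ℕ → ℝ} (habar : 0 ≤ abar) (hγ : 0 ≤ γ)
    (hβ : ∀ t, 0 ≤ β t)
    (hlam : ∀ t, lam (t + 1) = lam t + γ * ((if β t < α t then (1:ℝ) else 0) - abar))
    (hlam0 : lam 0 ≤ lmax) (hsat : ∀ t, lmax ≤ lam t → α t = 0) (t : ℕ) :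
    lam t ≤ lmax + γ := by
  have hprod : 0 ≤ γ * abar := mul_nonneg hγ habar
  induction t with
  | zero => linarith
  | succ t ih =>
    rw [hlam t]
    rcases le_or_gt lmax (lam t) with h | h
    · rw [if_neg (by rw [hsat t h]; exact (hβ t).not_gt)]
      linarith
    · split_ifs <;> linarith

/-- Telescoping the dual update expresses the number of errors through the dual variable. -/
theorem dual_variable_eq_sum {abar γ : ℝ} {e lam : ℕ → ℝ}
    (hlam : ∀ t, lam (t + 1) = lam t + γ * (e t - abar)) (T : ℕ) :
    lam T = lam 0 + γ * (∑ t ∈ Finset.range T, e t - T * abar) := by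
  induction T with
  | zero => simp
  | succ T ih =>
    rw [hlam T, ih, Finset.sum_range_succ]
    push_cast
    ring

/-- A nonnegative sequence bounded by `a + k / (c * T)` has `limsup` at most `a`. -/
theorem limsup_le_of_le_add_div {f : ℕ → ℝ} {a k c : ℝ} (hf : ∀ T, 0 ≤ f T)
    (hle : ∀ T : ℕ, 0 < T → f T ≤ a + k / (c * T)) :
    Filter.limsup f Filter.atTop ≤ a := by
  have hlim : Filter.Tendsto (fun T : ℕ => a + k / (c * T)) Filter.atTop (nhds a) := by
    simpa [div_div] using (tendsto_const_div_atTop_nhds_zero_nat (k / c)).const_add a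
  rw [← hlim.limsup_eq]
  refine Filter.limsup_le_limsup ?_ ?_ hlim.isBoundedUnder_le
  · filter_upwards [Filter.eventually_gt_atTop 0] with T hT using hle T hT
  · exact (Filter.isBoundedUnder_of ⟨0, hf⟩ :
      Filter.IsBoundedUnder (· ≥ ·) Filter.atTop f).isCoboundedUnder_le

/-- The paper's target guarantee (equation (1)) for the Model Prediction Set
procedure: the long-run empirical miscoverage rate of the calibrated model
prediction sets is at most the target rate, with a nonasymptotic bound.
Here `C t b` denotes the model set `C_t(1-b)` at nominal miscoverage rate
`b ∈ [0,1]`, `Mbest (t+1)` is the best model at time `t+1`, and the safeguard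
`C_t(1) = 𝓜` reads `C t 0 = Set.univ`. -/
theorem mps_target_guarantee {M : Type*} [Nonempty M]
    (C : ℕ → ℝ → Set M)
    (hmono : ∀ t, ∀ β₁ β₂, β₁ ∈ Set.Icc (0:ℝ) 1 → β₂ ∈ Set.Icc (0:ℝ) 1 →
      β₂ < β₁ → C t β₁ ⊆ C t β₂)
    (hsafe : ∀ t, C t 0 = Set.univ)
    (Mbest : ℕ → M)
    (β : ℕ → ℝ)
    (hβ : ∀ t, β t = sSup {b : ℝ | b ∈ Set.Icc (0:ℝ) 1 ∧ Mbest (t + 1) ∈ C t b})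
    (hattained : ∀ t, Mbest (t + 1) ∈ C t (β t))
    (abar lmax c γ : ℝ)
    (habar : abar ∈ Set.Ioo (0:ℝ) 1) (hlmax : 0 < lmax)
    (hc : c ∈ Set.Ioo (0:ℝ) 1) (hγ : γ = c * lmax)
    (α lam : ℕ → ℝ)
    (hα : ∀ t, α t ∈ Set.Icc (0:ℝ) 1)
    (hlam : ∀ t, lam (t + 1)
      = lam t + γ * ((if β t < α t then (1:ℝ) else 0) - abar))
    (hlam0 : lam 0 ∈ Set.Icc (0:ℝ) lmax)
    (hsat : ∀ t, lmax ≤ lam t → α t = 0) :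
    Filter.limsup
        (fun T : ℕ => (1 / (T:ℝ)) *
          ∑ t ∈ Finset.range T, (if Mbest (t + 1) ∉ C t (α t) then (1:ℝ) else 0))
        Filter.atTop ≤ abar ∧
      ∀ T : ℕ, 0 < T →
        (1 / (T:ℝ)) *
            (∑ t ∈ Finset.range T, (if Mbest (t + 1) ∉ C t (α t) then (1:ℝ) else 0))
          ≤ abar + (c + 1) / (c * T) := by
  have hβmem : ∀ t, β t ∈ Set.Icc (0:ℝ) 1 := fun t => by
    rw [hβ t]
    exact ⟨Real.sSup_nonneg fun b hb => hb.1.1, Real.sSup_le (fun b hb => hb.1.2) zero_le_one⟩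
  have hγpos : 0 < γ := hγ ▸ mul_pos hc.1 hlmax
  have hmiss : ∀ t, Mbest (t + 1) ∉ C t (α t) → β t < α t := fun t h => by
    by_contra! hle
    rcases hle.eq_or_lt with heq | hlt
    · exact h (heq ▸ hattained t)
    · exact h (hmono t _ _ (hβmem t) (hα t) hlt (hattained t))
  have hbound : ∀ T : ℕ, 0 < T →
      (1 / (T:ℝ)) *
          (∑ t ∈ Finset.range T, (if Mbest (t + 1) ∉ C t (α t) then (1:ℝ) else 0))
        ≤ abar + (c + 1) / (c * T) := by
    intro T hT
    have hTpos : (0:ℝ) < T := Nat.cast_pos.mpr hT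
    have hsum : (∑ t ∈ Finset.range T, (if Mbest (t + 1) ∉ C t (α t) then (1:ℝ) else 0))
        ≤ ∑ t ∈ Finset.range T, (if β t < α t then (1:ℝ) else 0) := by
      refine Finset.sum_le_sum fun t _ => ?_
      by_cases h : Mbest (t + 1) ∉ C t (α t)
      · rw [if_pos h, if_pos (hmiss t h)]
      · rw [if_neg h]
        split_ifs <;> norm_num
    have hdual := dual_variable_le habar.1.le hγpos.le (fun t => (hβmem t).1) hlam hlam0.2 hsat T
    rw [dual_variable_eq_sum hlam T] at hdual
    have herr : (∑ t ∈ Finset.range T, (if β t < α t then (1:ℝ) else 0)) - T * abar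
        ≤ (c + 1) / c := by
      rw [le_div_iff₀ hc.1]
      refine le_of_mul_le_mul_right ?_ hlmax
      subst hγ
      linarith [hlam0.1]
    calc (1 / (T:ℝ)) *
          (∑ t ∈ Finset.range T, (if Mbest (t + 1) ∉ C t (α t) then (1:ℝ) else 0))
        ≤ (1 / (T:ℝ)) * (T * abar + (c + 1) / c) := by
          gcongr
          linarith
      _ = abar + (c + 1) / (c * T) := by
          have := hc.1.ne'
          field_simp
  refine ⟨limsup_le_of_le_add_div (fun T => ?_) hbound, hbound⟩
  exact mul_nonneg (by positivity) (Finset.sum_nonneg fun t _ => by split_ifs <;> norm_num)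
end
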